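/- Combinatorial form of Proposition 4.4: For all constants k, ℓ ≥ 1 there exist constants C and W such that every k-ordered tree T with n ≥ 2 nodes whose nodes are labelled from a set of ℓ labels admits a hierarchical definition P of depth at most C·log₂ n, width at most W, and with at most C·n/log₂ n pairwise inequivalent patterns. -/

import Mathlib

/-- A finite rooted ordered tree, given by its finite, prefix-closed set of node
positions; a position is the list of child directions from the root.  In a
`k`-ordered tree every node has, for each `i : Fin k`, at most one `i`-th child,
which is automatic in this representation. -/
structure PosTree (k : ℕ) where
  nodes : Finset (List (Fin k))
  root_mem : [] ∈ nodes
  prefix_closed : ∀ u v : List (Fin k), u <+: v → v ∈ nodes → u ∈ nodes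

/-- A pattern in a tree: either a subtree pattern (a single node) or a context
pattern (a pair of a node and a proper descendant). -/
inductive Pattern (k : ℕ) : Type
  | subtree : List (Fin k) → Pattern k
  | context : List (Fin k) → List (Fin k) → Pattern k
deriving DecidableEq

/-- Validity of a pattern in a tree `T`: the nodes belong to `T`, and for a
context pattern `(v,w)` the node `w` is a proper descendant of `v`. -/
def Pattern.Valid {k : ℕ} (T : PosTree k) : Pattern k → Prop
  | .subtree v => v ∈ T.nodes
  | .context v w => v ∈ T.nodes ∧ w ∈ T.nodes ∧ v <+: w ∧ v ≠ w

/-- The set `V[p]` of nodes covered by a pattern. -/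
def Pattern.cover {k : ℕ} (T : PosTree k) : Pattern k → Set (List (Fin k))
  | .subtree v => {u | u ∈ T.nodes ∧ v <+: u}
  | .context v w => {u | u ∈ T.nodes ∧ v <+: u ∧ ¬ w <+: u}

/-- A hierarchical definition of `T`: a well-nested set of valid patterns
containing the largest pattern (the root of `T`). -/
structure IsHierDef {k : ℕ} (T : PosTree k) (P : Finset (Pattern k)) : Prop where
  valid : ∀ p ∈ P, p.Valid T
  root_mem : Pattern.subtree ([] : List (Fin k)) ∈ P
  nested : ∀ p ∈ P, ∀ q ∈ P,
    Disjoint (p.cover T) (q.cover T) ∨ p.cover T ⊆ q.cover T ∨ q.cover T ⊆ p.cover T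

/-- `q` is a direct subpattern of `p` (with respect to `P`): `q < p` and no
`r ∈ P` lies strictly between them. -/
def DirectSub {k : ℕ} (T : PosTree k) (P : Finset (Pattern k))
    (q p : Pattern k) : Prop :=
  q ∈ P ∧ p ∈ P ∧ q.cover T ⊂ p.cover T ∧
    ∀ r ∈ P, ¬ (q.cover T ⊂ r.cover T ∧ r.cover T ⊂ p.cover T)

/-- The boundary `∂p`: the nodes covered by `p` but by no direct subpattern. -/
def boundary {k : ℕ} (T : PosTree k) (P : Finset (Pattern k)) (p : Pattern k) :
    Set (List (Fin k)) :=
  p.cover T \ ⋃ q ∈ {q | DirectSub T P q p}, q.cover T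

/-- The size of the branching tree of `p`: the number of boundary nodes plus the
number of direct subpatterns (each direct subpattern is contracted to a single
node). -/
noncomputable def branchSize {k : ℕ} (T : PosTree k) (P : Finset (Pattern k))
    (p : Pattern k) : ℕ :=
  (boundary T P p).ncard + {q | DirectSub T P q p}.ncard

/-- The width of `P` is at most `W`: every branching tree has size at most `W`. -/
def WidthLE {k : ℕ} (T : PosTree k) (P : Finset (Pattern k)) (W : ℕ) : Prop :=
  ∀ p ∈ P, branchSize T P p ≤ W

/-- The depth of `P` (the height of its pattern tree) is at most `d`: every
strictly decreasing chain of patterns of `P` has at most `d + 1` elements. -/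
def DepthLE {k : ℕ} (T : PosTree k) (P : Finset (Pattern k)) (d : ℕ) : Prop :=
  ∀ c : List (Pattern k), (∀ p ∈ c, p ∈ P) →
    c.Chain' (fun p q => q.cover T ⊂ p.cover T) → c.length ≤ d + 1

/-- Equivalence of two patterns `p₁, p₂ ∈ P` of a node-labelled tree: a label-
and order-preserving isomorphism between `(T[p₁], P[p₁])` and `(T[p₂], P[p₂])`,
i.e. a bijection of the covered node sets preserving labels and the `i`-th child
relation and mapping the subpatterns of `p₁` belonging to `P` onto those of
`p₂`. -/
def Equivalent {k ℓ : ℕ} (T : PosTree k) (label : List (Fin k) → Fin ℓ)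
    (P : Finset (Pattern k)) (p₁ p₂ : Pattern k) : Prop :=
  ∃ φ : List (Fin k) → List (Fin k),
    Set.BijOn φ (p₁.cover T) (p₂.cover T) ∧
    (∀ u ∈ p₁.cover T, label (φ u) = label u) ∧
    (∀ u ∈ p₁.cover T, ∀ v ∈ p₁.cover T, ∀ i : Fin k,
       (v = u ++ [i] ↔ φ v = φ u ++ [i])) ∧
    (∀ q ∈ P, q.cover T ⊆ p₁.cover T →
       ∃ q' ∈ P, q'.cover T ⊆ p₂.cover T ∧ φ '' q.cover T = q'.cover T) ∧
    (∀ q' ∈ P, q'.cover T ⊆ p₂.cover T →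
       ∃ q ∈ P, q.cover T ⊆ p₁.cover T ∧ φ '' q.cover T = q'.cover T)

/-- `P` has at most `m` pairwise inequivalent patterns: some set of at most `m`
patterns of `P` meets every equivalence class. -/
def InequivLE {k ℓ : ℕ} (T : PosTree k) (label : List (Fin k) → Fin ℓ)
    (P : Finset (Pattern k)) (m : ℕ) : Prop :=
  ∃ reps : Finset (Pattern k), reps ⊆ P ∧ reps.card ≤ m ∧
    ∀ p ∈ P, ∃ q ∈ reps, Equivalent T label P p q

abbrev Pat (k : ℕ) := List (Fin k) × Option (List (Fin k))

open scoped Classical in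
noncomputable def cov {k : ℕ} (S : Finset (List (Fin k))) (p : Pat k) : Finset (List (Fin k)) :=
  S.filter (fun u => p.1 <+: u ∧ ∀ g ∈ p.2, ¬ (p.1 ++ g) <+: u)

theorem mem_cov {k : ℕ} {S : Finset (List (Fin k))} {p : Pat k} {u : List (Fin k)} :
    u ∈ cov S p ↔ u ∈ S ∧ p.1 <+: u ∧ ∀ g ∈ p.2, ¬ (p.1 ++ g) <+: u := by
  simp [cov]

def flag {α : Type} (h : Option α) : ℕ := if h.isSome then 1 else 0

noncomputable def rk {k : ℕ} (S : Finset (List (Fin k))) (p : Pat k) : ℕ :=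
  2 * Nat.log 2 (cov S p).card + flag p.2

structure Shape {k : ℕ} (S : Finset (List (Fin k))) (h : Option (List (Fin k))) : Prop where
  root : [] ∈ S
  pc : ∀ u v : List (Fin k), u <+: v → v ∈ S → u ∈ S
  hole : ∀ g ∈ h, g ∉ S

structure ChildOK {k : ℕ} (S : Finset (List (Fin k))) (h : Option (List (Fin k)))
    (c : Pat k) : Prop where
  mem : c.1 ∈ S
  hole : ∀ g ∈ c.2, g ≠ [] ∧ (c.1 ++ g ∈ S ∨ h = some (c.1 ++ g))
  cons : ∀ g ∈ h, c.1 <+: g → ∃ g' ∈ c.2, (c.1 ++ g') <+: g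

structure SplitOK {k : ℕ} (S : Finset (List (Fin k))) (h : Option (List (Fin k)))
    (D : Finset (Pat k)) : Prop where
  ok : ∀ c ∈ D, ChildOK S h c
  rk : ∀ c ∈ D, rk S c < 2 * Nat.log 2 S.card + flag h
  disj : ∀ c ∈ D, ∀ c' ∈ D, c ≠ c' → Disjoint (cov S c) (cov S c')
  card : D.card ≤ k + 1
  bd : ∃ x ∈ S, ∀ u ∈ S, u ≠ x ↔ ∃ c ∈ D, u ∈ cov S c

theorem log_half {a N : ℕ} (ha : a ≠ 0) (h : 2 * a ≤ N) : Nat.log 2 a + 1 ≤ Nat.log 2 N := by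
  calc Nat.log 2 a + 1 = Nat.log 2 (a * 2) := (Nat.log_mul_base (by norm_num) ha).symm
    _ ≤ _ := Nat.log_mono_right (by omega)

theorem pre_snoc {k : ℕ} {x u : List (Fin k)} (h : x <+: u) (hne : u ≠ x) :
    ∃ i, x ++ [i] <+: u := by
  obtain ⟨t, rfl⟩ := h
  cases t with
  | nil => simp at hne
  | cons i t => exact ⟨i, t, by simp⟩

theorem snoc_inj {k : ℕ} {x u : List (Fin k)} {i j : Fin k} (h : x ++ [i] <+: u)
    (h' : x ++ [j] <+: u) : i = j := by
  obtain ⟨t, rfl⟩ := h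
  obtain ⟨t', h'⟩ := h'
  simp at h'
  exact h'.1.symm

/-- the hole of the child `x ++ [i]` -/
noncomputable def chole {k : ℕ} (h : Option (List (Fin k))) (y : List (Fin k)) :
    Option (List (Fin k)) :=
  open scoped Classical in
  match h with
  | none => none
  | some g => if y <+: g then some (g.drop y.length) else none

theorem mem_chole {k : ℕ} {h : Option (List (Fin k))} {y g' : List (Fin k)} :
    g' ∈ chole h y ↔ h = some (y ++ g') := by
  cases h with
  | none => simp [chole]
  | some g =>
    simp only [chole]
    split_ifs with hy
    · obtain ⟨t, rfl⟩ := hy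
      simp [eq_comm]
    · simp only [Option.mem_def, Option.some.injEq]
      constructor
      · intro h; cases h
      · rintro rfl; exact absurd (List.prefix_append _ _) hy

theorem split {k : ℕ} (S : Finset (List (Fin k))) (h : Option (List (Fin k)))
    (hs : Shape S h) : ∃ D, SplitOK S h D := by
  classical
  let sz : List (Fin k) → ℕ := fun x => (S.filter (fun u => x <+: u)).card
  let cand := S.filter (fun x => (∀ g ∈ h, x <+: g) ∧ S.card < 2 * sz x)
  have hpos : 0 < S.card := Finset.card_pos.2 ⟨_, hs.root⟩
  have hcand : cand.Nonempty := by
    refine ⟨[], ?_⟩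
    have : sz [] = S.card := by simp [sz]
    simp only [cand, Finset.mem_filter]
    refine ⟨hs.root, fun g _ => List.nil_prefix, by omega⟩
  obtain ⟨x, hx, hmax⟩ := Finset.exists_max_image cand List.length hcand
  simp only [cand, Finset.mem_filter] at hx hmax
  obtain ⟨hxS, hxg, hxs⟩ := hx
  have hnoext : ∀ g ∈ h, ∀ u ∈ S, ¬ g <+: u := fun g hg u hu hp => hs.hole g hg (hs.pc _ _ hp hu)
  let ch : Fin k → Pat k := fun i => (x ++ [i], chole h (x ++ [i]))
  let D1 : Finset (Pat k) := (Finset.univ.filter (fun i => x ++ [i] ∈ S)).image ch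
  let D0 : Finset (Pat k) := if x = [] then ∅ else {([], some x)}
  have hD1 : ∀ c, c ∈ D1 ↔ ∃ i, x ++ [i] ∈ S ∧ ch i = c := by intro c; simp [D1]
  have hD0 : ∀ c, c ∈ D0 ↔ x ≠ [] ∧ c = ([], some x) := by
    intro c; by_cases hx : x = [] <;> simp [D0, hx]
  have cov1 : ∀ i u, u ∈ cov S (ch i) ↔ u ∈ S ∧ x ++ [i] <+: u := by
    intro i u
    rw [mem_cov]
    constructor
    · rintro ⟨a, b, _⟩; exact ⟨a, b⟩
    · rintro ⟨a, b⟩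
      refine ⟨a, b, fun g hg => ?_⟩
      exact hnoext _ (mem_chole.1 hg) u a
  have cov0 : ∀ u, u ∈ cov S ([], some x) ↔ u ∈ S ∧ ¬ x <+: u := by
    intro u; rw [mem_cov]; simp
  have card1 : ∀ i, (cov S (ch i)).card = sz (x ++ [i]) := by
    intro i; congr 1; ext u; rw [cov1]; simp
  have card0 : (cov S ([], some x)).card + sz x = S.card := by
    have : cov S ([], some x) = S.filter (fun u => ¬ x <+: u) := by ext u; rw [cov0]; simp
    rw [this, add_comm]
    exact Finset.card_filter_add_card_filter_not _
  have szpos : ∀ y ∈ S, sz y ≠ 0 := by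
    intro y hy
    exact (Finset.card_pos.2 ⟨y, by simp [hy]⟩).ne'
  have hle : ∀ y, sz y ≤ S.card := fun y => Finset.card_filter_le _ _
  have hsmall : ∀ i, x ++ [i] ∈ S → (∀ g ∈ h, x ++ [i] <+: g) → 2 * sz (x ++ [i]) ≤ S.card := by
    intro i hi hg
    by_contra hc
    have := hmax (x ++ [i]) ⟨hi, hg, by omega⟩
    simp at this
  refine ⟨D0 ∪ D1, ?_, ?_, ?_, ?_, ?_⟩
  · intro c hc
    rcases Finset.mem_union.1 hc with hc | hc
    · obtain ⟨hx0, rfl⟩ := (hD0 c).1 hc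
      refine ⟨hs.root, ?_, ?_⟩
      · intro g hg
        simp at hg; subst hg
        exact ⟨hx0, Or.inl (by simpa using hxS)⟩
      · intro g hg _
        exact ⟨x, by simp, by simpa using hxg g hg⟩
    · obtain ⟨i, hi, rfl⟩ := (hD1 c).1 hc
      refine ⟨hi, ?_, ?_⟩
      · intro g hg
        have hg' := mem_chole.1 hg
        refine ⟨?_, Or.inr hg'⟩
        rintro rfl
        exact hs.hole _ hg' (by simpa using hi)
      · intro g hg hp
        obtain ⟨t, rfl⟩ := hp
        exact ⟨t, mem_chole.2 hg, List.prefix_rfl⟩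
  · intro c hc
    rcases Finset.mem_union.1 hc with hc | hc
    · obtain ⟨hx0, rfl⟩ := (hD0 c).1 hc
      have h1 : (cov S ([], some x)).card ≠ 0 := by
        refine (Finset.card_pos.2 ⟨[], ?_⟩).ne'
        rw [cov0]; exact ⟨hs.root, by simpa using hx0⟩
      have := log_half h1 (N := S.card) (by omega)
      simp only [rk, flag]; simp; omega
    · obtain ⟨i, hi, rfl⟩ := (hD1 c).1 hc
      simp only [rk, card1]
      by_cases hg : ∀ g ∈ h, x ++ [i] <+: g
      · have := log_half (szpos _ hi) (hsmall i hi hg)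
        have h2 : flag (ch i).2 ≤ 1 := by unfold flag; split_ifs <;> omega
        omega
      · push Not at hg
        obtain ⟨g, hg, hng⟩ := hg
        have h3 : Nat.log 2 (sz (x ++ [i])) ≤ Nat.log 2 S.card := Nat.log_mono_right (hle _)
        have h4 : (ch i).2 = none := by
          simp only [ch]
          rw [Option.eq_none_iff_forall_not_mem]
          intro a ha
          have := mem_chole.1 ha
          rw [Option.mem_def, this] at hg
          simp at hg; subst hg; simp at hng
        rw [Option.mem_def] at hg
        rw [h4, hg]
        simp only [flag]; simp; omega
  · have key : ∀ c ∈ D0, ∀ c' ∈ D1, Disjoint (cov S c) (cov S c') := by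
      intro c hc c' hc'
      obtain ⟨hx0, rfl⟩ := (hD0 c).1 hc
      obtain ⟨i, hi, rfl⟩ := (hD1 c').1 hc'
      rw [Finset.disjoint_left]
      intro u hu hu'
      rw [cov0] at hu; rw [cov1] at hu'
      exact hu.2 ((List.prefix_append _ _).trans hu'.2)
    intro c hc c' hc' hne
    rcases Finset.mem_union.1 hc with hc | hc <;> rcases Finset.mem_union.1 hc' with hc' | hc'
    · exact absurd (((hD0 c).1 hc).2.trans ((hD0 c').1 hc').2.symm) hne
    · exact key c hc c' hc'
    · exact (key c' hc' c hc).symm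
    · obtain ⟨i, hi, rfl⟩ := (hD1 c).1 hc
      obtain ⟨j, hj, rfl⟩ := (hD1 c').1 hc'
      rw [Finset.disjoint_left]
      intro u hu hu'
      rw [cov1] at hu hu'
      exact hne (by rw [snoc_inj hu.2 hu'.2])
  · have h0 : D0.card ≤ 1 := by simp only [D0]; split_ifs <;> simp
    have h1 : D1.card ≤ k := by
      refine Finset.card_image_le.trans ((Finset.card_filter_le _ _).trans (by simp))
    have := Finset.card_union_le D0 D1
    omega
  · refine ⟨x, hxS, fun u hu => ⟨fun hne => ?_, ?_⟩⟩
    · by_cases hp : x <+: u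
      · obtain ⟨i, hi⟩ := pre_snoc hp hne
        exact ⟨ch i, Finset.mem_union_right _ ((hD1 _).2 ⟨i, hs.pc _ _ hi hu, rfl⟩),
          (cov1 _ _).2 ⟨hu, hi⟩⟩
      · refine ⟨([], some x), Finset.mem_union_left _ ((hD0 _).2 ⟨?_, rfl⟩), (cov0 _).2 ⟨hu, hp⟩⟩
        rintro rfl; simp at hp
    · rintro ⟨c, hc, huc⟩ rfl
      rcases Finset.mem_union.1 hc with hc | hc
      · obtain ⟨hx0, rfl⟩ := (hD0 c).1 hc
        rw [cov0] at huc; simp at huc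
      · obtain ⟨i, hi, rfl⟩ := (hD1 c).1 hc
        rw [cov1] at huc
        have := huc.2.length_le
        simp at this

open scoped Classical in
noncomputable def spl {k : ℕ} (S : Finset (List (Fin k))) (h : Option (List (Fin k))) :
    Finset (Pat k) :=
  if hs : Shape S h then (split S h hs).choose else ∅

theorem spl_ok {k : ℕ} {S : Finset (List (Fin k))} {h : Option (List (Fin k))}
    (hs : Shape S h) : SplitOK S h (spl S h) := by
  unfold spl; rw [dif_pos hs]; exact (split S h hs).choose_spec

/-- Relative shape of a pattern. -/
noncomputable def sh {k : ℕ} (T : PosTree k) (p : Pat k) : Finset (List (Fin k)) :=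
  (cov T.nodes p).image (List.drop p.1.length)

theorem mem_sh {k : ℕ} {T : PosTree k} {p : Pat k} {u : List (Fin k)} :
    u ∈ sh T p ↔ p.1 ++ u ∈ T.nodes ∧ ∀ g ∈ p.2, ¬ g <+: u := by
  simp only [sh, Finset.mem_image, mem_cov]
  constructor
  · rintro ⟨w, ⟨h1, ⟨t, rfl⟩, h3⟩, rfl⟩
    simp only [List.drop_left]
    refine ⟨h1, fun g hg hp => h3 g hg ?_⟩
    exact (List.prefix_append_right_inj _).2 hp
  · rintro ⟨h1, h2⟩
    refine ⟨p.1 ++ u, ⟨h1, List.prefix_append _ _, fun g hg hp => h2 g hg ?_⟩, by simp⟩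
    exact (List.prefix_append_right_inj _).1 hp

theorem cov_eq_sh {k : ℕ} (T : PosTree k) (p : Pat k) :
    cov T.nodes p = (sh T p).image (p.1 ++ ·) := by
  ext u
  simp only [Finset.mem_image, mem_sh, mem_cov]
  constructor
  · rintro ⟨h1, ⟨t, rfl⟩, h3⟩
    exact ⟨t, ⟨h1, fun g hg hp => h3 g hg ((List.prefix_append_right_inj _).2 hp)⟩, rfl⟩
  · rintro ⟨t, ⟨h1, h2⟩, rfl⟩
    exact ⟨h1, List.prefix_append _ _,
      fun g hg hp => h2 g hg ((List.prefix_append_right_inj _).1 hp)⟩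

theorem card_sh {k : ℕ} (T : PosTree k) (p : Pat k) : (sh T p).card = (cov T.nodes p).card := by
  rw [cov_eq_sh, Finset.card_image_of_injective]
  intro a b h
  exact List.append_cancel_left h

structure Val {k : ℕ} (T : PosTree k) (p : Pat k) : Prop where
  mem : p.1 ∈ T.nodes
  hole : ∀ g ∈ p.2, g ≠ [] ∧ p.1 ++ g ∈ T.nodes

theorem Val.shape {k : ℕ} {T : PosTree k} {p : Pat k} (h : Val T p) : Shape (sh T p) p.2 := by
  refine ⟨?_, ?_, ?_⟩
  · rw [mem_sh]
    refine ⟨by simpa using h.mem, fun g hg hp => (h.hole g hg).1 (by simpa using hp)⟩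
  · intro u v huv hv
    rw [mem_sh] at hv ⊢
    exact ⟨T.prefix_closed _ _ ((List.prefix_append_right_inj _).2 huv) hv.1,
      fun g hg hp => hv.2 g hg (hp.trans huv)⟩
  · intro g hg hm
    rw [mem_sh] at hm
    exact hm.2 g hg List.prefix_rfl

def shift {k : ℕ} (v : List (Fin k)) (c : Pat k) : Pat k := (v ++ c.1, c.2)

theorem ChildOK.val {k : ℕ} {T : PosTree k} {p c : Pat k} (h : Val T p)
    (hc : ChildOK (sh T p) p.2 c) : Val T (shift p.1 c) := by
  refine ⟨(mem_sh.1 hc.mem).1, fun g hg => ⟨(hc.hole g hg).1, ?_⟩⟩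
  simp only [shift, List.append_assoc]
  rcases (hc.hole g hg).2 with h1 | h1
  · exact (mem_sh.1 h1).1
  · exact (h.hole _ h1).2

theorem ChildOK.mem_sh {k : ℕ} {T : PosTree k} {p c : Pat k}
    (hc : ChildOK (sh T p) p.2 c) (u : List (Fin k)) :
    u ∈ sh T (shift p.1 c) ↔ c.1 ++ u ∈ sh T p ∧ ∀ g ∈ c.2, ¬ g <+: u := by
  rw [_root_.mem_sh, _root_.mem_sh]
  simp only [shift, List.append_assoc]
  constructor
  · rintro ⟨h1, h2⟩
    refine ⟨⟨h1, fun g hg hp => ?_⟩, h2⟩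
    rcases List.prefix_or_prefix_of_prefix hp (List.prefix_append c.1 u) with h3 | h3
    · exact (_root_.mem_sh.1 hc.mem).2 g hg h3
    · obtain ⟨g', hg', h4⟩ := hc.cons g hg h3
      exact h2 g' hg' ((List.prefix_append_right_inj _).1 (h4.trans hp))
  · rintro ⟨⟨h1, h3⟩, h2⟩
    exact ⟨h1, h2⟩

theorem ChildOK.cov {k : ℕ} {T : PosTree k} {p c : Pat k}
    (hc : ChildOK (sh T p) p.2 c) :
    cov T.nodes (shift p.1 c) = (cov (sh T p) c).image (p.1 ++ ·) := by
  rw [cov_eq_sh]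
  ext w
  simp only [Finset.mem_image, hc.mem_sh, mem_cov]
  constructor
  · rintro ⟨u, ⟨h1, h2⟩, rfl⟩
    exact ⟨c.1 ++ u, ⟨h1, List.prefix_append _ _,
      fun g hg hp => h2 g hg ((List.prefix_append_right_inj _).1 hp)⟩, by simp [shift]⟩
  · rintro ⟨_, ⟨h1, ⟨u, rfl⟩, h2⟩, rfl⟩
    exact ⟨u, ⟨h1, fun g hg hp => h2 g hg ((List.prefix_append_right_inj _).2 hp)⟩,
      by simp [shift]⟩

noncomputable def child {k : ℕ} (T : PosTree k) (p : Pat k) : Finset (Pat k) :=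
  (spl (sh T p) p.2).image (shift p.1)

theorem mem_child {k : ℕ} {T : PosTree k} {p q : Pat k} :
    q ∈ child T p ↔ ∃ c ∈ spl (sh T p) p.2, shift p.1 c = q := by
  simp [child]

structure ChildrenOK {k : ℕ} (T : PosTree k) (p : Pat k) : Prop where
  val : ∀ c ∈ child T p, Val T c
  rk : ∀ c ∈ child T p, rk T.nodes c < rk T.nodes p
  disj : ∀ c ∈ child T p, ∀ c' ∈ child T p, c ≠ c' →
    Disjoint (cov T.nodes c) (cov T.nodes c')
  card : (child T p).card ≤ k + 1
  ssub : ∀ c ∈ child T p, cov T.nodes c ⊂ cov T.nodes p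
  bd : ∃ x, ∀ u ∈ cov T.nodes p, u ≠ x → ∃ c ∈ child T p, u ∈ cov T.nodes c

theorem children_ok {k : ℕ} {T : PosTree k} {p : Pat k} (h : Val T p) : ChildrenOK T p := by
  have hs := spl_ok h.shape
  have inj : Function.Injective (fun u : List (Fin k) => p.1 ++ u) :=
    fun a b h => List.append_cancel_left h
  obtain ⟨x, hx, hb⟩ := hs.bd
  refine ⟨?_, ?_, ?_, ?_, ?_, ?_⟩
  · intro q hq
    obtain ⟨c, hc, rfl⟩ := mem_child.1 hq
    exact (hs.ok c hc).val h
  · intro q hq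
    obtain ⟨c, hc, rfl⟩ := mem_child.1 hq
    have := hs.rk c hc
    rw [card_sh] at this
    unfold rk at this ⊢
    rw [(hs.ok c hc).cov, Finset.card_image_of_injective _ inj]
    exact this
  · intro q hq q' hq' hne
    obtain ⟨c, hc, rfl⟩ := mem_child.1 hq
    obtain ⟨c', hc', rfl⟩ := mem_child.1 hq'
    rw [(hs.ok c hc).cov, (hs.ok c' hc').cov, Finset.disjoint_image inj]
    exact hs.disj c hc c' hc' (fun h => hne (by rw [h]))
  · exact Finset.card_image_le.trans hs.card
  · intro q hq
    obtain ⟨c, hc, rfl⟩ := mem_child.1 hq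
    rw [(hs.ok c hc).cov, cov_eq_sh, Finset.ssubset_iff_of_subset]
    · refine ⟨p.1 ++ x, Finset.mem_image_of_mem _ hx, fun hm => ?_⟩
      obtain ⟨y, hy, hyx⟩ := Finset.mem_image.1 hm
      obtain rfl := inj hyx
      exact (hb y hx).2 ⟨c, hc, hy⟩ rfl
    · exact Finset.image_subset_image (fun u hu => (mem_cov.1 hu).1)
  · refine ⟨p.1 ++ x, fun u hu hne => ?_⟩
    rw [cov_eq_sh] at hu
    obtain ⟨y, hy, rfl⟩ := Finset.mem_image.1 hu
    obtain ⟨c, hc, hyc⟩ := (hb y hy).1 (fun h => hne (by rw [h]))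
    refine ⟨_, mem_child.2 ⟨c, hc, rfl⟩, ?_⟩
    rw [(hs.ok c hc).cov]
    exact Finset.mem_image_of_mem _ hyc

/-- reachability -/
def Rch {k : ℕ} (T : PosTree k) : Pat k → Pat k → Prop :=
  Relation.ReflTransGen (fun p q => q ∈ child T p)

theorem Rch.val {k : ℕ} {T : PosTree k} {p q : Pat k} (h : Rch T p q) (hp : Val T p) : Val T q := by
  induction h with
  | refl => exact hp
  | tail _ h ih => exact (children_ok ih).val _ h

theorem Rch.sub {k : ℕ} {T : PosTree k} {p q : Pat k} (h : Rch T p q) (hp : Val T p) :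
    cov T.nodes q ⊆ cov T.nodes p := by
  induction h with
  | refl => exact subset_rfl
  | tail h1 h ih => exact ((children_ok (Rch.val h1 hp)).ssub _ h).subset.trans ih

theorem Rch.rk_le {k : ℕ} {T : PosTree k} {p q : Pat k} (h : Rch T p q) (hp : Val T p) :
    rk T.nodes q ≤ rk T.nodes p := by
  induction h with
  | refl => exact le_rfl
  | tail h1 h ih => exact ((children_ok (Rch.val h1 hp)).rk _ h).le.trans ih

theorem Rch.cases {k : ℕ} {T : PosTree k} {p q : Pat k} (h : Rch T p q) :
    p = q ∨ ∃ c ∈ child T p, Rch T c q := by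
  rcases Relation.ReflTransGen.cases_head h with h | ⟨c, h1, h2⟩
  · exact Or.inl h
  · exact Or.inr ⟨c, h1, h2⟩

theorem Rch.laminar {k : ℕ} {T : PosTree k} {p q r : Pat k} (h : Rch T p q) (h' : Rch T p r)
    (hp : Val T p) : Disjoint (cov T.nodes q) (cov T.nodes r) ∨ Rch T q r ∨ Rch T r q := by
  induction h using Relation.ReflTransGen.head_induction_on with
  | refl => exact Or.inr (Or.inl h')
  | head h1 h2 ih =>
    rename_i a c
    rcases h'.cases with rfl | ⟨c', hc', h3⟩
    · exact Or.inr (Or.inr (Relation.ReflTransGen.head h1 h2))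
    · have ha := children_ok hp
      by_cases hcc : c = c'
      · subst hcc
        exact ih h3 (ha.val _ h1)
      · left
        exact Disjoint.mono (Rch.sub h2 (ha.val _ h1)) (h3.sub (ha.val _ hc'))
          (ha.disj _ h1 _ hc' hcc)

theorem Val.nonempty {k : ℕ} {T : PosTree k} {p : Pat k} (h : Val T p) :
    p.1 ∈ cov T.nodes p := by
  rw [mem_cov]
  refine ⟨h.mem, List.prefix_rfl, fun g hg hp => (h.hole g hg).1 ?_⟩
  have := hp.length_le
  simp at this
  exact this

/-- root pattern -/
def rt (k : ℕ) : Pat k := ([], none)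

theorem rt_val {k : ℕ} (T : PosTree k) : Val T (rt k) :=
  ⟨T.root_mem, by intro g hg; simp [rt] at hg⟩

theorem rch_of_sub {k : ℕ} {T : PosTree k} {q r : Pat k} (hq : Rch T (rt k) q)
    (hr : Rch T (rt k) r) (h : cov T.nodes q ⊆ cov T.nodes r) : Rch T r q := by
  have vq := hq.val (rt_val T)
  rcases hq.laminar hr (rt_val T) with h1 | h1 | h1
  · exact absurd (h vq.nonempty) (Finset.disjoint_left.1 h1 vq.nonempty)
  · rcases h1.cases with rfl | ⟨c, hc, h2⟩
    · exact Relation.ReflTransGen.refl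
    · have h3 := (children_ok vq).ssub c hc
      have h4 := h2.sub ((children_ok vq).val c hc)
      exact absurd (h.trans h4) h3.2
  · exact h1

theorem child_of_ssub {k : ℕ} {T : PosTree k} {q r : Pat k} (hq : Rch T (rt k) q)
    (hr : Rch T (rt k) r) (h : cov T.nodes q ⊂ cov T.nodes r) :
    ∃ c ∈ child T r, Rch T c q := by
  rcases (rch_of_sub hq hr h.subset).cases with rfl | h1
  · exact absurd h.1 h.2
  · exact h1

theorem rk_lt {k : ℕ} {T : PosTree k} {q r : Pat k} (hq : Rch T (rt k) q)
    (hr : Rch T (rt k) r) (h : cov T.nodes q ⊂ cov T.nodes r) :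
    rk T.nodes q < rk T.nodes r := by
  obtain ⟨c, hc, h1⟩ := child_of_ssub hq hr h
  have := children_ok (hr.val (rt_val T))
  exact (h1.rk_le (this.val c hc)).trans_lt (this.rk c hc)

theorem disj_of_rk {k : ℕ} {T : PosTree k} {q r : Pat k} (hq : Rch T (rt k) q)
    (hr : Rch T (rt k) r) (h : rk T.nodes q = rk T.nodes r) (hne : q ≠ r) :
    Disjoint (cov T.nodes q) (cov T.nodes r) := by
  rcases hq.laminar hr (rt_val T) with h1 | h1 | h1
  · exact h1
  · rcases h1.cases with h2 | ⟨c, hc, h2⟩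
    · exact absurd h2 hne
    · have := children_ok (hq.val (rt_val T))
      have h3 := (h2.rk_le (this.val c hc)).trans_lt (this.rk c hc)
      omega
  · rcases h1.cases with h2 | ⟨c, hc, h2⟩
    · exact absurd h2.symm hne
    · have := children_ok (hr.val (rt_val T))
      have h3 := (h2.rk_le (this.val c hc)).trans_lt (this.rk c hc)
      omega

/-- translation invariance -/
theorem Rch.translate {k : ℕ} {T : PosTree k} {p p' q : Pat k} (h : Rch T p q) (hp : Val T p)
    (hp' : Val T p') (hS : sh T p = sh T p') (hh : p.2 = p'.2) :
    ∃ c : Pat k, q = shift p.1 c ∧ Rch T p' (shift p'.1 c) ∧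
      sh T (shift p.1 c) = sh T (shift p'.1 c) := by
  induction h with
  | refl =>
    have e1 : shift p.1 ([], p.2) = p := by simp [shift]
    have e2 : shift p'.1 ([], p.2) = p' := by simp [shift, hh]
    refine ⟨([], p.2), e1.symm, ?_, ?_⟩
    · rw [e2]; exact Relation.ReflTransGen.refl
    · rw [e1, e2]; exact hS
  | tail h1 h2 ih =>
    obtain ⟨c, rfl, h3, h4⟩ := ih
    obtain ⟨d, hd, rfl⟩ := mem_child.1 h2
    have v1 := Rch.val h1 hp
    have v2 := h3.val hp'
    have k1 := (spl_ok v1.shape).ok d hd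
    have hd' : d ∈ spl (sh T (shift p'.1 c)) (shift p'.1 c).2 := by
      rw [← h4]; exact hd
    have k2 := (spl_ok v2.shape).ok d hd'
    have e : ∀ v : List (Fin k), shift (shift v c).1 d = shift v (c.1 ++ d.1, d.2) := by
      intro v; simp [shift]
    refine ⟨(c.1 ++ d.1, d.2), e _, ?_, ?_⟩
    · rw [← e]
      exact Relation.ReflTransGen.tail h3 (mem_child.2 ⟨d, hd', rfl⟩)
    · rw [← e, ← e]
      ext u
      rw [k1.mem_sh, k2.mem_sh, h4]

def decode {k : ℕ} {A : Type} [DecidableEq A] :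
    List (List (Fin k)) → List (Option A) → Finset (List (Fin k) × A)
  | [], _ => ∅
  | _ :: _, [] => ∅
  | _ :: q, none :: w => decode q w
  | x :: q, some a :: w =>
    insert (x, a) (decode ((List.finRange k).map (fun i => x ++ [i]) ++ q) w)

structure GoodKey {k : ℕ} {A : Type} (K : Finset (List (Fin k) × A)) : Prop where
  pc : ∀ u v b, u <+: v → (v, b) ∈ K → ∃ a, (u, a) ∈ K
  fn : ∀ u a b, (u, a) ∈ K → (u, b) ∈ K → a = b

open scoped Classical in
noncomputable def ksz {k : ℕ} {A : Type} (K : Finset (List (Fin k) × A)) (x : List (Fin k)) : ℕ :=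
  (K.filter (fun e => x <+: e.1)).card

theorem ksz_step {k : ℕ} {A : Type} {K : Finset (List (Fin k) × A)} (hK : GoodKey K)
    {x : List (Fin k)} {a : A} (hx : (x, a) ∈ K) :
    ksz K x = 1 + ∑ i, ksz K (x ++ [i]) := by
  classical
  have : K.filter (fun e => x <+: e.1) =
      insert (x, a) (Finset.univ.biUnion fun i => K.filter (fun e => x ++ [i] <+: e.1)) := by
    ext ⟨u, b⟩
    simp only [Finset.mem_filter, Finset.mem_insert, Finset.mem_biUnion, Finset.mem_univ, true_and,
      Prod.mk.injEq]
    constructor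
    · rintro ⟨h1, h2⟩
      by_cases hux : u = x
      · subst hux
        exact Or.inl ⟨rfl, hK.fn _ _ _ h1 hx⟩
      · obtain ⟨i, hi⟩ := pre_snoc h2 hux
        exact Or.inr ⟨i, h1, hi⟩
    · rintro (⟨rfl, rfl⟩ | ⟨i, h1, h2⟩)
      · exact ⟨hx, List.prefix_rfl⟩
      · exact ⟨h1, (List.prefix_append _ _).trans h2⟩
  unfold ksz
  rw [this, Finset.card_insert_of_notMem, Finset.card_biUnion, add_comm]
  · intro i _ j _ hij
    simp only [Function.onFun]
    rw [Finset.disjoint_left]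
    rintro ⟨u, b⟩ h1 h2
    simp only [Finset.mem_filter] at h1 h2
    exact hij (snoc_inj h1.2 h2.2)
  · simp only [Finset.mem_biUnion, Finset.mem_filter, not_exists]
    rintro i ⟨_, _, h⟩
    have := h.length_le
    simp at this

theorem exists_word {k : ℕ} {A : Type} [DecidableEq A] {K : Finset (List (Fin k) × A)}
    (hK : GoodKey K) (N : ℕ) : ∀ q : List (List (Fin k)),
    (q.map (fun x => 1 + k * ksz K x)).sum ≤ N →
    ∃ w : List (Option A), w.length = N ∧
      ∀ e, e ∈ decode q w ↔ e ∈ K ∧ ∃ x ∈ q, x <+: e.1 := by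
  classical
  induction N with
  | zero =>
    intro q hq
    cases q with
    | nil => exact ⟨[], rfl, by simp [decode]⟩
    | cons x q => simp at hq
  | succ N ih =>
    intro q hq
    cases q with
    | nil => exact ⟨List.replicate (N + 1) none, by simp, by simp [decode]⟩
    | cons x q =>
      simp only [List.map_cons, List.sum_cons] at hq
      by_cases hx : ∃ a, (x, a) ∈ K
      · obtain ⟨a, ha⟩ := hx
        obtain ⟨w, hw, hd⟩ := ih ((List.finRange k).map (fun i => x ++ [i]) ++ q) (by
          have := ksz_step hK ha
          rw [List.map_append, List.sum_append, List.map_map]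
          have e : (List.map ((fun x => 1 + k * ksz K x) ∘ fun i => x ++ [i])
              (List.finRange k)).sum = ∑ i : Fin k, (1 + k * ksz K (x ++ [i])) := by
            rw [Fin.sum_univ_def]; rfl
          rw [e, Finset.sum_add_distrib, ← Finset.mul_sum]
          rw [this, mul_add] at hq
          simp only [Finset.sum_const, Finset.card_univ, Fintype.card_fin, smul_eq_mul, mul_one]
          omega)
        refine ⟨some a :: w, by simp [hw], fun e => ?_⟩
        simp only [decode, Finset.mem_insert, hd, List.mem_append, List.mem_map, List.mem_cons]
        constructor
        · rintro (rfl | ⟨h1, y, (⟨i, _, rfl⟩ | hy), h2⟩)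
          · exact ⟨ha, x, Or.inl rfl, List.prefix_rfl⟩
          · exact ⟨h1, x, Or.inl rfl, (List.prefix_append _ _).trans h2⟩
          · exact ⟨h1, y, Or.inr hy, h2⟩
        · rintro ⟨h1, y, (rfl | hy), h2⟩
          · by_cases hey : e.1 = y
            · left
              obtain ⟨u, b⟩ := e
              simp only at hey
              subst hey
              rw [hK.fn _ _ _ h1 ha]
            · obtain ⟨i, hi⟩ := pre_snoc h2 hey
              exact Or.inr ⟨h1, _, Or.inl ⟨i, by simp, rfl⟩, hi⟩
          · exact Or.inr ⟨h1, y, Or.inr hy, h2⟩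
      · obtain ⟨w, hw, hd⟩ := ih q (by omega)
        refine ⟨none :: w, by simp [hw], fun e => ?_⟩
        simp only [decode, hd, List.mem_cons]
        constructor
        · rintro ⟨h1, y, hy, h2⟩
          exact ⟨h1, y, Or.inr hy, h2⟩
        · rintro ⟨h1, y, (rfl | hy), h2⟩
          · exact absurd (hK.pc _ _ _ h2 h1) hx
          · exact ⟨h1, y, hy, h2⟩

theorem card_keys {k : ℕ} {A : Type} [DecidableEq A] [Fintype A]
    (F : Finset (Finset (List (Fin k) × A))) (M : ℕ)
    (hF : ∀ K ∈ F, GoodKey K ∧ K.card ≤ M) :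
    F.card ≤ (Fintype.card A + 1) ^ (1 + k * M) := by
  classical
  have hsub : F ⊆ (Finset.univ : Finset (List.Vector (Option A) (1 + k * M))).image
      (fun w => decode [[]] w.1) := by
    intro K hK
    obtain ⟨h1, h2⟩ := hF K hK
    have h3 : ksz K [] ≤ M := (Finset.card_filter_le _ _).trans h2
    obtain ⟨w, hw, hd⟩ := exists_word h1 (1 + k * M) [[]] (by
      simp; exact Nat.mul_le_mul le_rfl h3)
    refine Finset.mem_image.2 ⟨⟨w, hw⟩, Finset.mem_univ _, ?_⟩
    ext e
    simp [hd]
  calc F.card ≤ _ := Finset.card_le_card hsub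
    _ ≤ _ := Finset.card_image_le
    _ = _ := by rw [Finset.card_univ, card_vector, Fintype.card_option]

noncomputable def key {k ℓ : ℕ} (T : PosTree k) (label : List (Fin k) → Fin ℓ) (p : Pat k) :
    Finset (List (Fin k) × Option (Fin ℓ)) :=
  (sh T p).image (fun u => (u, some (label (p.1 ++ u)))) ∪ p.2.toFinset.image (fun g => (g, none))

theorem mem_key_some {k ℓ : ℕ} {T : PosTree k} {label : List (Fin k) → Fin ℓ} {p : Pat k}
    {u : List (Fin k)} {a : Fin ℓ} :
    (u, some a) ∈ key T label p ↔ u ∈ sh T p ∧ label (p.1 ++ u) = a := by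
  simp [key]

theorem mem_key_none {k ℓ : ℕ} {T : PosTree k} {label : List (Fin k) → Fin ℓ} {p : Pat k}
    {u : List (Fin k)} :
    (u, none) ∈ key T label p ↔ u ∈ p.2 := by
  simp [key]

theorem key_card {k ℓ : ℕ} (T : PosTree k) (label : List (Fin k) → Fin ℓ) (p : Pat k) :
    (key T label p).card ≤ (cov T.nodes p).card + 1 := by
  refine (Finset.card_union_le _ _).trans (add_le_add ?_ ?_)
  · rw [← card_sh]; exact Finset.card_image_le
  · refine Finset.card_image_le.trans ?_
    cases p.2 <;> simp

theorem key_good {k ℓ : ℕ} {T : PosTree k} (label : List (Fin k) → Fin ℓ) {p : Pat k}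
    (hp : Val T p) : GoodKey (key T label p) := by
  have hs := hp.shape
  refine ⟨?_, ?_⟩
  · intro u v b huv hv
    cases b with
    | some b =>
      rw [mem_key_some] at hv
      exact ⟨_, mem_key_some.2 ⟨hs.pc _ _ huv hv.1, rfl⟩⟩
    | none =>
      rw [mem_key_none] at hv
      by_cases h : u = v
      · subst h; exact ⟨none, mem_key_none.2 hv⟩
      · refine ⟨_, mem_key_some.2 ⟨?_, rfl⟩⟩
        rw [mem_sh]
        refine ⟨T.prefix_closed _ _ ((List.prefix_append_right_inj _).2 huv) (hp.hole _ hv).2, ?_⟩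
        intro g hg hgu
        obtain rfl : v = g := Option.mem_unique hv hg
        exact h (huv.eq_of_length (le_antisymm huv.length_le hgu.length_le))
  · intro u a b ha hb
    cases a <;> cases b
    · rfl
    · exact absurd (mem_key_some.1 hb).1 (hs.hole _ (mem_key_none.1 ha))
    · exact absurd (mem_key_some.1 ha).1 (hs.hole _ (mem_key_none.1 hb))
    · rw [mem_key_some] at ha hb
      rw [← ha.2, ← hb.2]

theorem key_eq {k ℓ : ℕ} {T : PosTree k} {label : List (Fin k) → Fin ℓ} {p p' : Pat k}
    (h : key T label p = key T label p') :
    sh T p = sh T p' ∧ p.2 = p'.2 ∧ ∀ u ∈ sh T p, label (p.1 ++ u) = label (p'.1 ++ u) := by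
  refine ⟨?_, ?_, ?_⟩
  · ext u
    constructor
    · intro hu
      have := (mem_key_some (label := label)).2 ⟨hu, rfl⟩
      rw [h] at this
      exact (mem_key_some.1 this).1
    · intro hu
      have := (mem_key_some (label := label)).2 ⟨hu, rfl⟩
      rw [← h] at this
      exact (mem_key_some.1 this).1
  · ext u
    rw [← Option.mem_def, ← Option.mem_def, ← mem_key_none (T := T) (label := label), h,
      mem_key_none]
  · intro u hu
    have := (mem_key_some (label := label)).2 ⟨hu, rfl⟩
    rw [h] at this
    exact (mem_key_some.1 this).2.symm

def toP {k : ℕ} : Pat k → Pattern k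
  | (v, none) => .subtree v
  | (v, some g) => .context v (v ++ g)

theorem toP_inj {k : ℕ} : Function.Injective (toP (k := k)) := by
  rintro ⟨v, _ | g⟩ ⟨v', _ | g'⟩ h <;> simp [toP] at h
  · simp [h]
  · obtain ⟨rfl, h⟩ := h
    simp at h; simp [h]

theorem cover_toP {k : ℕ} (T : PosTree k) (p : Pat k) :
    (toP p).cover T = (cov T.nodes p : Set (List (Fin k))) := by
  obtain ⟨v, _ | g⟩ := p <;> ext u <;> simp [toP, Pattern.cover, mem_cov]

theorem valid_toP {k : ℕ} {T : PosTree k} {p : Pat k} (h : Val T p) : (toP p).Valid T := by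
  obtain ⟨v, _ | g⟩ := p
  · exact h.mem
  · have := h.hole g rfl
    refine ⟨h.mem, this.2, List.prefix_append _ _, ?_⟩
    simpa using this.1

theorem fin_rch {k : ℕ} (T : PosTree k) : {p | Rch T (rt k) p}.Finite := by
  classical
  refine Set.Finite.subset (s := (↑((T.nodes.image (fun v => ((v, none) : Pat k))) ∪
    (T.nodes ×ˢ T.nodes).image (fun e => ((e.1, some (e.2.drop e.1.length)) : Pat k))) :
      Set (Pat k))) (Finset.finite_toSet _) ?_
  intro p hp
  have hv := Rch.val hp (rt_val T)
  obtain ⟨v, _ | g⟩ := p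
  · simp; exact hv.mem
  · simp
    exact ⟨v ++ g, ⟨hv.mem, (hv.hole g rfl).2⟩, by simp⟩

noncomputable def PP {k : ℕ} (T : PosTree k) : Finset (Pat k) := (fin_rch T).toFinset

theorem mem_PP {k : ℕ} {T : PosTree k} {p : Pat k} : p ∈ PP T ↔ Rch T (rt k) p := by
  simp [PP]

noncomputable def QQ {k : ℕ} (T : PosTree k) : Finset (Pattern k) := (PP T).image toP

theorem mem_QQ {k : ℕ} {T : PosTree k} {p : Pattern k} :
    p ∈ QQ T ↔ ∃ q, Rch T (rt k) q ∧ toP q = p := by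
  simp only [QQ, Finset.mem_image, mem_PP]

theorem hier {k : ℕ} (T : PosTree k) : IsHierDef T (QQ T) := by
  refine ⟨?_, ?_, ?_⟩
  · intro p hp
    obtain ⟨q, hq, rfl⟩ := mem_QQ.1 hp
    exact valid_toP (hq.val (rt_val T))
  · exact mem_QQ.2 ⟨rt k, Relation.ReflTransGen.refl, rfl⟩
  · intro p hp q hq
    rw [mem_QQ] at hp
    obtain ⟨p, hp, rfl⟩ := hp
    rw [mem_QQ] at hq
    obtain ⟨q, hq, rfl⟩ := hq
    simp only [cover_toP, Finset.disjoint_coe, Finset.coe_subset]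
    rcases hp.laminar hq (rt_val T) with h | h | h
    · exact Or.inl h
    · exact Or.inr (Or.inr (h.sub (hp.val (rt_val T))))
    · exact Or.inr (Or.inl (h.sub (hq.val (rt_val T))))

theorem directSub_iff {k : ℕ} {T : PosTree k} {p : Pat k} (hp : Rch T (rt k) p) :
    {q | DirectSub T (QQ T) q (toP p)} = toP '' (child T p : Set (Pat k)) := by
  have vp := hp.val (rt_val T)
  have hc := children_ok vp
  ext q
  simp only [Set.mem_ofPred_eq, Set.mem_image, Finset.mem_coe]
  constructor
  · rintro ⟨h1, _, h3, h4⟩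
    obtain ⟨q, hq, rfl⟩ := mem_QQ.1 h1
    simp only [cover_toP, Finset.coe_ssubset] at h3 h4
    obtain ⟨c, hcp, hcq⟩ := child_of_ssub hq hp h3
    refine ⟨c, hcp, ?_⟩
    rcases hcq.cases with rfl | ⟨d, hd, hdq⟩
    · rfl
    · exfalso
      have vc := hc.val c hcp
      have rc : Rch T (rt k) c := Relation.ReflTransGen.tail hp hcp
      have := h4 (toP c) (mem_QQ.2 ⟨c, rc, rfl⟩)
      rw [cover_toP, Finset.coe_ssubset, Finset.coe_ssubset] at this
      refine this ⟨?_, hc.ssub c hcp⟩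
      exact lt_of_le_of_lt (hdq.sub ((children_ok vc).val d hd)) ((children_ok vc).ssub d hd)
  · rintro ⟨c, hcp, rfl⟩
    have rc : Rch T (rt k) c := Relation.ReflTransGen.tail hp hcp
    refine ⟨mem_QQ.2 ⟨c, rc, rfl⟩, mem_QQ.2 ⟨p, hp, rfl⟩, ?_, ?_⟩
    · rw [cover_toP, cover_toP, Finset.coe_ssubset]; exact hc.ssub c hcp
    · rintro r hr ⟨h1, h2⟩
      rw [mem_QQ] at hr
      obtain ⟨r, hr, rfl⟩ := hr
      rw [cover_toP, cover_toP, Finset.coe_ssubset] at h1 h2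
      obtain ⟨d, hd, hdr⟩ := child_of_ssub hr hp h2
      have vd := hc.val d hd
      have hsub := h1.1.trans (hdr.sub vd)
      by_cases hcd : c = d
      · subst hcd
        exact h1.2 (hdr.sub vd)
      · have vc := (hc.val c hcp).nonempty
        exact Finset.disjoint_left.1 (hc.disj c hcp d hd hcd) vc (hsub vc)

theorem width {k : ℕ} (T : PosTree k) : WidthLE T (QQ T) (k + 2) := by
  intro p hp
  rw [mem_QQ] at hp
  obtain ⟨p, hp, rfl⟩ := hp
  have vp := hp.val (rt_val T)
  have hc := children_ok vp
  obtain ⟨x, hx⟩ := hc.bd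
  have h1 : (boundary T (QQ T) (toP p)).ncard ≤ 1 := by
    have : boundary T (QQ T) (toP p) ⊆ {x} := by
      rintro u ⟨hu, hn⟩
      by_contra hne
      rw [cover_toP] at hu
      obtain ⟨c, hcp, huc⟩ := hx u hu hne
      apply hn
      rw [directSub_iff hp]
      simp only [Set.mem_iUnion]
      refine ⟨toP c, ⟨c, hcp, rfl⟩, ?_⟩
      rw [cover_toP]; exact huc
    exact (Set.ncard_le_ncard this (Set.finite_singleton x)).trans (by simp)
  have h2 : {q | DirectSub T (QQ T) q (toP p)}.ncard ≤ k + 1 := by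
    rw [directSub_iff hp]
    refine (Set.ncard_image_le (Finset.finite_toSet _)).trans ?_
    rw [Set.ncard_coe_finset]; exact hc.card
  unfold branchSize
  omega

theorem rk_rt {k : ℕ} (T : PosTree k) : rk T.nodes (rt k) = 2 * Nat.log 2 T.nodes.card := by
  have : cov T.nodes (rt k) = T.nodes := by ext u; simp [mem_cov, rt]
  unfold rk
  rw [this]
  simp [flag, rt]

theorem depth {k : ℕ} (T : PosTree k) : DepthLE T (QQ T) (2 * Nat.log 2 T.nodes.card) := by
  have key : ∀ (c : List (Pattern k)), (∀ p ∈ c, p ∈ QQ T) →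
      c.IsChain (fun p q => q.cover T ⊂ p.cover T) → ∀ p, Rch T (rt k) p →
      c.head? = some (toP p) → c.length ≤ rk T.nodes p + 1 := by
    intro c
    induction c with
    | nil => intro _ _ p _ h; simp at h
    | cons a c ih =>
      intro h1 h2 p hp h3
      simp at h3; subst h3
      cases c with
      | nil => simp
      | cons b c =>
        obtain ⟨q, hq, rfl⟩ := mem_QQ.1 (h1 b (by simp))
        rw [List.isChain_cons_cons] at h2
        have h4 := ih (fun p hp => h1 p (by simp [hp])) h2.2 q hq rfl
        have h5 := h2.1
        rw [cover_toP, cover_toP, Finset.coe_ssubset] at h5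
        have := rk_lt hq hp h5
        simp at h4 ⊢
        omega
  intro c h1 h2
  cases c with
  | nil => simp
  | cons a c =>
    obtain ⟨q, hq, rfl⟩ := mem_QQ.1 (h1 a (by simp))
    have h3 := key _ h1 h2 q hq rfl
    have h4 := hq.rk_le (rt_val T)
    rw [rk_rt] at h4
    omega

theorem equiv_of_key {k ℓ : ℕ} {T : PosTree k} {label : List (Fin k) → Fin ℓ} {p p' : Pat k}
    (hp : Rch T (rt k) p) (hp' : Rch T (rt k) p') (h : key T label p = key T label p') :
    Equivalent T label (QQ T) (toP p) (toP p') := by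
  obtain ⟨hS, hh, hl⟩ := key_eq h
  have vp := hp.val (rt_val T)
  have vp' := hp'.val (rt_val T)
  let φ : List (Fin k) → List (Fin k) := fun u => p'.1 ++ u.drop p.1.length
  have φe : ∀ u, φ (p.1 ++ u) = p'.1 ++ u := by intro u; simp [φ]
  have him : ∀ c : Pat k, sh T (shift p.1 c) = sh T (shift p'.1 c) →
      φ '' (cov T.nodes (shift p.1 c) : Set (List (Fin k))) =
        (cov T.nodes (shift p'.1 c) : Set (List (Fin k))) := by
    intro c hc
    rw [cov_eq_sh, cov_eq_sh, hc, Finset.coe_image, Finset.coe_image, Set.image_image]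
    apply Set.image_congr
    intro u _
    simp only [shift, List.append_assoc, φe]
  have hm : ∀ u, u ∈ (toP p).cover T ↔ ∃ a ∈ sh T p, u = p.1 ++ a := by
    intro u; rw [cover_toP, cov_eq_sh]; simp [eq_comm]
  have hm' : ∀ u, u ∈ (toP p').cover T ↔ ∃ a ∈ sh T p, u = p'.1 ++ a := by
    intro u; rw [cover_toP, cov_eq_sh, hS]; simp [eq_comm]
  refine ⟨φ, ⟨?_, ?_, ?_⟩, ?_, ?_, ?_, ?_⟩
  · intro u hu
    obtain ⟨a, ha, rfl⟩ := (hm u).1 hu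
    exact (hm' _).2 ⟨a, ha, φe a⟩
  · intro u hu w hw huw
    obtain ⟨a, ha, rfl⟩ := (hm u).1 hu
    obtain ⟨b, hb, rfl⟩ := (hm w).1 hw
    rw [φe, φe] at huw
    rw [List.append_cancel_left huw]
  · intro u hu
    obtain ⟨a, ha, rfl⟩ := (hm' u).1 hu
    exact ⟨p.1 ++ a, (hm _).2 ⟨a, ha, rfl⟩, φe a⟩
  · intro u hu
    obtain ⟨a, ha, rfl⟩ := (hm u).1 hu
    rw [φe, hl a ha]
  · intro u hu w hw i
    obtain ⟨a, ha, rfl⟩ := (hm u).1 hu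
    obtain ⟨b, hb, rfl⟩ := (hm w).1 hw
    rw [φe, φe, List.append_assoc, List.append_assoc, List.append_cancel_left_eq,
      List.append_cancel_left_eq]
  · intro q hq hsub
    rw [mem_QQ] at hq
    obtain ⟨q, hq, rfl⟩ := hq
    rw [cover_toP, cover_toP, Finset.coe_subset] at hsub
    obtain ⟨c, rfl, h1, h2⟩ := (rch_of_sub hq hp hsub).translate vp vp' hS hh
    refine ⟨toP (shift p'.1 c), mem_QQ.2 ⟨_, hp'.trans h1, rfl⟩, ?_, ?_⟩
    · rw [cover_toP, cover_toP, Finset.coe_subset]; exact h1.sub vp'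
    · rw [cover_toP, cover_toP]; exact him c h2
  · intro q hq hsub
    rw [mem_QQ] at hq
    obtain ⟨q, hq, rfl⟩ := hq
    rw [cover_toP, cover_toP, Finset.coe_subset] at hsub
    obtain ⟨c, rfl, h1, h2⟩ := (rch_of_sub hq hp' hsub).translate vp' vp hS.symm hh.symm
    refine ⟨toP (shift p.1 c), mem_QQ.2 ⟨_, hp.trans h1, rfl⟩, ?_, ?_⟩
    · rw [cover_toP, cover_toP, Finset.coe_subset]; exact h1.sub vp
    · rw [cover_toP, cover_toP]; exact him c h2.symm

theorem count_rank {k : ℕ} (T : PosTree k) (F : Finset (Pat k)) (r j : ℕ)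
    (hF : ∀ p ∈ F, Rch T (rt k) p ∧ rk T.nodes p = r ∧ 2 ^ j ≤ (cov T.nodes p).card) :
    F.card * 2 ^ j ≤ T.nodes.card := by
  classical
  calc F.card * 2 ^ j ≤ ∑ p ∈ F, (cov T.nodes p).card := by
        rw [← smul_eq_mul]; exact Finset.card_nsmul_le_sum _ _ _ (fun p hp => (hF p hp).2.2)
    _ = (F.biUnion (cov T.nodes)).card := by
        rw [Finset.card_biUnion]
        intro p hp q hq hne
        exact disj_of_rk (hF p hp).1 (hF q hq).1 ((hF p hp).2.1.trans (hF q hq).2.1.symm) hne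
    _ ≤ _ := Finset.card_le_card (by
        intro u hu
        obtain ⟨p, _, hu⟩ := Finset.mem_biUnion.1 hu
        exact (mem_cov.1 hu).1)

theorem count_level {k : ℕ} (T : PosTree k) (j : ℕ) :
    ((PP T).filter (fun p => Nat.log 2 (cov T.nodes p).card = j)).card * 2 ^ j
      ≤ 2 * T.nodes.card := by
  classical
  set F := (PP T).filter (fun p => Nat.log 2 (cov T.nodes p).card = j)
  have hsz : ∀ p ∈ F, Rch T (rt k) p ∧ Nat.log 2 (cov T.nodes p).card = j ∧
      2 ^ j ≤ (cov T.nodes p).card := by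
    intro p hp
    obtain ⟨h1, h2⟩ := Finset.mem_filter.1 hp
    have h3 := mem_PP.1 h1
    refine ⟨h3, h2, ?_⟩
    rw [← h2]
    exact Nat.pow_log_le_self 2 (Finset.card_pos.2 ⟨_, (h3.val (rt_val T)).nonempty⟩).ne'
  have h1 := count_rank T (F.filter (fun p => p.2.isSome)) (2 * j + 1) j (by
    intro p hp
    obtain ⟨h1, h2⟩ := Finset.mem_filter.1 hp
    obtain ⟨a, b, c⟩ := hsz p h1
    exact ⟨a, by simp [rk, b, flag, h2], c⟩)
  have h2 := count_rank T (F.filter (fun p => ¬ p.2.isSome)) (2 * j) j (by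
    intro p hp
    obtain ⟨h1, h2⟩ := Finset.mem_filter.1 hp
    obtain ⟨a, b, c⟩ := hsz p h1
    exact ⟨a, by simp only [rk, b, flag, if_neg h2, add_zero], c⟩)
  have h3 := Finset.card_filter_add_card_filter_not (s := F) (fun p => p.2.isSome = true)
  rw [← h3, add_mul]
  omega

theorem count_big {k : ℕ} (T : PosTree k) (J : ℕ) :
    ((PP T).filter (fun p => J ≤ Nat.log 2 (cov T.nodes p).card)).card * 2 ^ J
      ≤ 4 * T.nodes.card := by
  classical
  have key : ∀ M, ((PP T).filter (fun p => J ≤ Nat.log 2 (cov T.nodes p).card ∧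
      Nat.log 2 (cov T.nodes p).card < J + M)).card * 2 ^ (J + M) + 4 * T.nodes.card
      ≤ 4 * T.nodes.card * 2 ^ M := by
    intro M
    induction M with
    | zero =>
      rw [Finset.filter_false_of_mem]
      · simp
      · intro p _; omega
    | succ M ih =>
      have h1 := count_level T (J + M)
      have h2 : (PP T).filter (fun p => J ≤ Nat.log 2 (cov T.nodes p).card ∧
          Nat.log 2 (cov T.nodes p).card < J + (M + 1)) =
          (PP T).filter (fun p => J ≤ Nat.log 2 (cov T.nodes p).card ∧
          Nat.log 2 (cov T.nodes p).card < J + M) ∪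
          (PP T).filter (fun p => Nat.log 2 (cov T.nodes p).card = J + M) := by
        ext p
        simp only [Finset.mem_filter, Finset.mem_union]
        constructor
        · rintro ⟨a, b, c⟩
          by_cases h : Nat.log 2 (cov T.nodes p).card = J + M
          · exact Or.inr ⟨a, h⟩
          · exact Or.inl ⟨a, b, by omega⟩
        · rintro (⟨a, b, c⟩ | ⟨a, b⟩)
          · exact ⟨a, b, by omega⟩
          · exact ⟨a, by omega, by omega⟩
      have h3 := Finset.card_union_le ((PP T).filter (fun p => J ≤ Nat.log 2 (cov T.nodes p).card ∧
          Nat.log 2 (cov T.nodes p).card < J + M))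
          ((PP T).filter (fun p => Nat.log 2 (cov T.nodes p).card = J + M))
      rw [← h2] at h3
      have h4 := Nat.mul_le_mul_right (2 ^ (J + M)) h3
      rw [add_mul] at h4
      have e1 : 2 ^ (J + (M + 1)) = 2 * 2 ^ (J + M) := by ring
      have e2 : 2 ^ (M + 1) = 2 * 2 ^ M := by ring
      rw [e1, e2]
      nlinarith
  have h1 := key (Nat.log 2 T.nodes.card + 1)
  have h2 : (PP T).filter (fun p => J ≤ Nat.log 2 (cov T.nodes p).card ∧
      Nat.log 2 (cov T.nodes p).card < J + (Nat.log 2 T.nodes.card + 1)) =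
      (PP T).filter (fun p => J ≤ Nat.log 2 (cov T.nodes p).card) := by
    apply Finset.filter_congr
    intro p _
    have : Nat.log 2 (cov T.nodes p).card ≤ Nat.log 2 T.nodes.card :=
      Nat.log_mono_right (Finset.card_le_card (fun u hu => (mem_cov.1 hu).1))
    omega
  rw [h2] at h1
  have hpos : 0 < 2 ^ (Nat.log 2 T.nodes.card + 1) := by positivity
  rw [pow_add, ← mul_assoc] at h1
  exact Nat.le_of_mul_le_mul_right (le_trans (Nat.le_add_right _ _) h1) hpos

theorem ineq {k ℓ : ℕ} (T : PosTree k) (label : List (Fin k) → Fin ℓ) (J : ℕ) :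
    ∃ b : ℕ, b * 2 ^ J ≤ 4 * T.nodes.card ∧
      InequivLE T label (QQ T) (b + (ℓ + 2) ^ (1 + k * 2 ^ J)) := by
  classical
  set big := (PP T).filter (fun p => J ≤ Nat.log 2 (cov T.nodes p).card) with hbig
  set small := (PP T).filter (fun p => ¬ J ≤ Nat.log 2 (cov T.nodes p).card) with hsm
  obtain ⟨R, hR, hRc⟩ : ∃ R ⊆ small, R.card ≤ (small.image (key T label)).card ∧
      ∀ p ∈ small, ∃ q ∈ R, key T label p = key T label q := by
    have hch : ∀ K ∈ small.image (key T label), ∃ p, p ∈ small ∧ key T label p = K := by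
      intro K hK; simpa using hK
    choose! f hf using hch
    refine ⟨(small.image (key T label)).image f, ?_, Finset.card_image_le, ?_⟩
    · intro p hp
      obtain ⟨K, hK, rfl⟩ := Finset.mem_image.1 hp
      exact (hf K hK).1
    · intro p hp
      have h1 := Finset.mem_image_of_mem (key T label) hp
      exact ⟨f (key T label p), Finset.mem_image_of_mem _ h1, (hf _ h1).2.symm⟩
  have hc := card_keys (small.image (key T label)) (2 ^ J) (by
    intro K hK
    obtain ⟨p, hp, rfl⟩ := Finset.mem_image.1 hK
    obtain ⟨h1, h2⟩ := Finset.mem_filter.1 hp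
    refine ⟨key_good label ((mem_PP.1 h1).val (rt_val T)), ?_⟩
    refine (key_card T label p).trans ?_
    have := Nat.lt_pow_of_log_lt (b := 2) (by norm_num) (not_le.1 h2)
    omega)
  rw [Fintype.card_option, Fintype.card_fin] at hc
  refine ⟨big.card, count_big T J, (big ∪ R).image toP, ?_, ?_, ?_⟩
  · apply Finset.image_subset_image
    exact Finset.union_subset (Finset.filter_subset _ _) (hR.trans (Finset.filter_subset _ _))
  · refine Finset.card_image_le.trans ((Finset.card_union_le _ _).trans ?_)
    exact add_le_add le_rfl (hRc.1.trans hc)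
  · intro p hp
    rw [mem_QQ] at hp
    obtain ⟨p, hp, rfl⟩ := hp
    by_cases h : J ≤ Nat.log 2 (cov T.nodes p).card
    · refine ⟨toP p, Finset.mem_image_of_mem _ (Finset.mem_union_left _
        (Finset.mem_filter.2 ⟨mem_PP.2 hp, h⟩)), equiv_of_key hp hp rfl⟩
    · obtain ⟨q, hq, hk⟩ := hRc.2 p (Finset.mem_filter.2 ⟨mem_PP.2 hp, h⟩)
      refine ⟨toP q, Finset.mem_image_of_mem _ (Finset.mem_union_right _ hq), ?_⟩
      exact equiv_of_key hp (mem_PP.1 (Finset.mem_filter.1 (hR hq)).1) hk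

theorem arith (k c n b J L K : ℕ) (hk : 1 ≤ k) (hc : 1 ≤ c) (hn : 2 ≤ n)
    (hL : L = Nat.log 2 n) (hK : K = 2 * (c * k)) (hJ : J = Nat.log 2 (L / K))
    (hb : b * 2 ^ J ≤ 4 * n) :
    (b + c ^ (1 + k * 2 ^ J)) * (L + 1) ≤ (8 * K + 2 * 2 ^ (c + c * k)) * n := by
  have hck : 0 < c * k := Nat.mul_pos hc hk
  have hKpos : 0 < K := by omega
  have h1 : L + 1 ≤ 2 * 2 ^ J * K := by
    have h2 : L / K < 2 ^ (J + 1) := by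
      rw [hJ]; exact Nat.lt_pow_succ_log_self (by norm_num) _
    have h3 : L < K * (L / K + 1) := Nat.lt_mul_div_succ L hKpos
    have h4 : K * (L / K + 1) ≤ K * 2 ^ (J + 1) := Nat.mul_le_mul le_rfl h2
    have : K * 2 ^ (J + 1) = 2 * 2 ^ J * K := by ring
    omega
  have h5 : 2 ^ J ≤ 1 + L / K := by
    rcases Nat.eq_zero_or_pos (L / K) with h | h
    · rw [hJ, h]; simp
    · have := Nat.pow_log_le_self 2 h.ne'
      rw [hJ]; omega
  have h6 : c * k * (L / K) ≤ L / 2 := by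
    rw [hK, ← Nat.div_div_eq_div_mul]
    exact Nat.mul_div_le _ _
  set y := 2 ^ (L / 2) with hy
  have h7 : c ^ (1 + k * 2 ^ J) ≤ 2 ^ (c + c * k) * y := by
    calc c ^ (1 + k * 2 ^ J) ≤ (2 ^ c) ^ (1 + k * 2 ^ J) :=
          Nat.pow_le_pow_left (Nat.lt_two_pow_self).le _
      _ = 2 ^ (c * (1 + k * 2 ^ J)) := by rw [← pow_mul]
      _ ≤ 2 ^ (c + c * k + L / 2) := by
          apply Nat.pow_le_pow_right (by norm_num)
          calc c * (1 + k * 2 ^ J) = c + c * k * 2 ^ J := by ring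
            _ ≤ c + c * k * (1 + L / K) := by gcongr
            _ = c + c * k + c * k * (L / K) := by ring
            _ ≤ _ := by omega
      _ = _ := by rw [pow_add]
  have h8 : y * y ≤ n := by
    rw [hy, ← pow_add]
    calc 2 ^ (L / 2 + L / 2) ≤ 2 ^ L := Nat.pow_le_pow_right (by norm_num) (by omega)
      _ ≤ n := by rw [hL]; exact Nat.pow_log_le_self 2 (by omega)
  have h9 : L + 1 ≤ 2 * y := by
    have : L / 2 < y := Nat.lt_two_pow_self
    omega
  have e1 : b * (L + 1) ≤ 8 * K * n := by
    calc b * (L + 1) ≤ b * (2 * 2 ^ J * K) := Nat.mul_le_mul le_rfl h1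
      _ = 2 * K * (b * 2 ^ J) := by ring
      _ ≤ 2 * K * (4 * n) := Nat.mul_le_mul le_rfl hb
      _ = _ := by ring
  have e2 : c ^ (1 + k * 2 ^ J) * (L + 1) ≤ 2 * 2 ^ (c + c * k) * n := by
    calc c ^ (1 + k * 2 ^ J) * (L + 1) ≤ (2 ^ (c + c * k) * y) * (2 * y) :=
          Nat.mul_le_mul h7 h9
      _ = 2 * 2 ^ (c + c * k) * (y * y) := by ring
      _ ≤ _ := Nat.mul_le_mul le_rfl h8
  rw [add_mul, add_mul]
  exact add_le_add e1 e2

/-- Combinatorial form of Proposition 4.4. -/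
theorem stmt8 (k ℓ : ℕ) (hk : 1 ≤ k) (hℓ : 1 ≤ ℓ) :
    ∃ (C : ℝ) (W : ℕ), 0 < C ∧
      ∀ (T : PosTree k) (label : List (Fin k) → Fin ℓ) (n : ℕ),
        n = T.nodes.card → 2 ≤ n →
        ∃ P : Finset (Pattern k), IsHierDef T P ∧ WidthLE T P W ∧
          (∃ d : ℕ, (d : ℝ) ≤ C * Real.logb 2 n ∧ DepthLE T P d) ∧
          (∃ m : ℕ, (m : ℝ) ≤ C * n / Real.logb 2 n ∧ InequivLE T label P m) := by
  refine ⟨((8 * (2 * ((ℓ + 2) * k)) + 2 * 2 ^ ((ℓ + 2) + (ℓ + 2) * k) : ℕ) : ℝ), k + 2, ?_, ?_⟩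
  · exact_mod_cast (by positivity)
  intro T label n hn hn2
  have hpow : 1 ≤ 2 ^ ((ℓ + 2) + (ℓ + 2) * k) := Nat.one_le_two_pow
  have hn0 : (0 : ℝ) < n := by exact_mod_cast (by omega : 0 < n)
  have hlog1 : ((Nat.log 2 n : ℕ) : ℝ) ≤ Real.logb 2 n := by
    rw [Real.le_logb_iff_rpow_le (by norm_num) hn0, Real.rpow_natCast]
    exact_mod_cast Nat.pow_log_le_self 2 (by omega)
  have hlog2 : Real.logb 2 n ≤ ((Nat.log 2 n + 1 : ℕ) : ℝ) := by
    rw [Real.logb_le_iff_le_rpow (by norm_num) hn0, Real.rpow_natCast]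
    exact_mod_cast (Nat.lt_pow_succ_log_self (by norm_num : 1 < 2) n).le
  have hLpos : 1 ≤ Nat.log 2 n := Nat.log_pos (by norm_num) hn2
  have hlpos : 0 < Real.logb 2 n := by
    have : (1 : ℝ) ≤ ((Nat.log 2 n : ℕ) : ℝ) := by exact_mod_cast hLpos
    linarith
  refine ⟨QQ T, hier T, width T, ⟨2 * Nat.log 2 n, ?_, ?_⟩, ?_⟩
  · have h2 : (2 : ℝ) ≤ ((8 * (2 * ((ℓ + 2) * k)) + 2 * 2 ^ ((ℓ + 2) + (ℓ + 2) * k) : ℕ) : ℝ) := by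
      exact_mod_cast (by omega : 2 ≤ 8 * (2 * ((ℓ + 2) * k)) + 2 * 2 ^ ((ℓ + 2) + (ℓ + 2) * k))
    push_cast only [Nat.cast_mul]
    exact mul_le_mul (by simpa using h2) hlog1 (by positivity) (by positivity)
  · rw [hn]; exact depth T
  · set J := Nat.log 2 (Nat.log 2 n / (2 * ((ℓ + 2) * k))) with hJ
    obtain ⟨b, hb, hi⟩ := ineq T label J
    rw [← hn] at hb
    refine ⟨_, ?_, hi⟩
    have h := arith k (ℓ + 2) n b J _ _ hk (by omega) hn2 rfl rfl hJ hb
    rw [le_div_iff₀ hlpos]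
    calc ((b + (ℓ + 2) ^ (1 + k * 2 ^ J) : ℕ) : ℝ) * Real.logb 2 n
        ≤ ((b + (ℓ + 2) ^ (1 + k * 2 ^ J) : ℕ) : ℝ) * ((Nat.log 2 n + 1 : ℕ) : ℝ) :=
          mul_le_mul_of_nonneg_left hlog2 (Nat.cast_nonneg _)
      _ ≤ _ := by exact_mod_cast h
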